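/- Let f ∈ 𝓡(m) be non-degenerate and let ψ : Fin m → Fin m be a map. Then ψ_*f lies in 𝓡(m) and is non-degenerate if and only if ψ is a bijection. (In particular, for every permutation ψ of Fin m and every non-degenerate f ∈ 𝓡(m), the polynomial ψ_*f is again a non-degenerate element of 𝓡(m).) -/

import Mathlib

open MvPolynomial

/-- `f ∈ 𝓡(n)`: `f` is a sum of distinct monic squarefree monomials of positive
degree: all coefficients of monomials in the support are `1`, all exponents are
`≤ 1`, and the constant coefficient vanishes. -/
def IsRPoly {n : ℕ} (f : MvPolynomial (Fin n) ℤ) : Prop :=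
  (∀ d ∈ f.support, f.coeff d = 1) ∧
  (∀ d ∈ f.support, ∀ i, d i ≤ 1) ∧
  f.coeff 0 = 0

/-- `f` is non-degenerate if every variable occurs in `f`,
i.e. `∂f/∂a_s ≠ 0` for all `s`. -/
def NonDegen {n : ℕ} (f : MvPolynomial (Fin n) ℤ) : Prop :=
  ∀ s : Fin n, MvPolynomial.pderiv s f ≠ 0

theorem IsRPoly.rename {m n : ℕ} {f : MvPolynomial (Fin m) ℤ} (hf : IsRPoly f)
    {φ : Fin m → Fin n} (hφ : Function.Injective φ) : IsRPoly (MvPolynomial.rename φ f) := by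
  classical
  obtain ⟨hcoeff, hexp, hconst⟩ := hf
  refine ⟨fun d hd => ?_, fun d hd i => ?_, ?_⟩
  · rw [support_rename_of_injective hφ, Finset.mem_image] at hd
    obtain ⟨e, he, rfl⟩ := hd
    rw [coeff_rename_mapDomain φ hφ, hcoeff e he]
  · rw [support_rename_of_injective hφ, Finset.mem_image] at hd
    obtain ⟨e, he, rfl⟩ := hd
    by_cases hi : i ∈ Set.range φ
    · obtain ⟨j, rfl⟩ := hi
      rw [Finsupp.mapDomain_apply hφ]
      exact hexp e he j
    · rw [Finsupp.mapDomain_of_notMem_range e i hi]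
      exact zero_le_one
  · rw [← Finsupp.mapDomain_zero (f := φ), coeff_rename_mapDomain φ hφ, hconst]

theorem NonDegen.rename {m n : ℕ} {f : MvPolynomial (Fin m) ℤ} (hf : NonDegen f)
    {φ : Fin m → Fin n} (hφ : Function.Bijective φ) : NonDegen (MvPolynomial.rename φ f) := by
  intro s
  obtain ⟨i, rfl⟩ := hφ.surjective s
  rw [pderiv_rename hφ.injective, Ne, map_eq_zero_iff _ (rename_injective φ hφ.injective)]
  exact hf i

theorem NonDegen.surjective_of_rename {m n : ℕ} {f : MvPolynomial (Fin m) ℤ} {φ : Fin m → Fin n}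
    (h : NonDegen (MvPolynomial.rename φ f)) : Function.Surjective φ := by
  intro s
  have hs : s ∈ (MvPolynomial.rename φ f).vars :=
    by_contra fun hs => h s (pderiv_eq_zero_of_notMem_vars hs)
  obtain ⟨i, -, hi⟩ := mem_vars_rename φ f hs
  exact ⟨i, hi⟩

/-- For non-degenerate `f ∈ 𝓡(m)` and `ψ : Fin m → Fin m`: `ψ_* f` is a
non-degenerate element of `𝓡(m)` iff `ψ` is a bijection. -/
theorem rename_self_nondegen_iff_bijective (m : ℕ)
    (f : MvPolynomial (Fin m) ℤ) (hf : IsRPoly f) (hnd : NonDegen f)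
    (ψ : Fin m → Fin m) :
    (IsRPoly (MvPolynomial.rename ψ f) ∧ NonDegen (MvPolynomial.rename ψ f)) ↔
      Function.Bijective ψ := by
  exact ⟨fun h => Finite.surjective_iff_bijective.mp h.2.surjective_of_rename,
    fun h => ⟨hf.rename h.injective, hnd.rename h⟩⟩
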